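/- arXiv:1607.00956 — 6 statements merged into one kernel-verified Lean document; each statement's English description precedes it below -/
import Mathlib

section
/- Suppose q0 is a probability distribution on X with full support that minimizes the dissipation functional W_d over all probability distributions on X. Then for every probability distribution r0 on X, W_d(r0) − W_d(q0) = D(r0‖q0) − D(r0P‖q0P), i.e., the extra dissipation incurred by initial distribution r0 equals the contraction of the Kullback–Leibler divergence between r0 and q0 under the push-forward by the kernel P. -/
open Finset

/-- `p` is a probability distribution on the finite set `X`. -/
def IsProb {X : Type*} [Fintype X] (p : X → ℝ) : Prop :=
  (∀ x, 0 ≤ p x) ∧ ∑ x, p x = 1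

/-- `P` is a row-stochastic kernel on `X`; `P x0 x1` denotes `P(x1|x0)`. -/
def IsKernel {X : Type*} [Fintype X] (P : X → X → ℝ) : Prop :=
  (∀ x0 x1, 0 ≤ P x0 x1) ∧ ∀ x0, ∑ x1, P x0 x1 = 1

/-- Push-forward of `p` under the kernel `P`: `(pP)(x1) = Σ_{x0} p(x0) P(x1|x0)`. -/
def push {X : Type*} [Fintype X] (P : X → X → ℝ) (p : X → ℝ) : X → ℝ :=
  fun x1 => ∑ x0, p x0 * P x0 x1

/-- Shannon entropy with natural logarithm (`Real.log 0 = 0` gives the `0 ln 0 = 0` convention). -/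
noncomputable def shannon {X : Type*} [Fintype X] (p : X → ℝ) : ℝ :=
  -∑ x, p x * Real.log (p x)

/-- Dissipation functional `W_d(p) = S(pP) − S(p) − Σ_x p(x) Q(x)`. -/
noncomputable def Wd {X : Type*} [Fintype X] (P : X → X → ℝ) (Q : X → ℝ) (p : X → ℝ) : ℝ :=
  shannon (push P p) - shannon p - ∑ x, p x * Q x

/-- Kullback–Leibler divergence `D(r‖q) = Σ_x r(x) ln(r(x)/q(x))`
(terms with `r x = 0` vanish since `0 * log _ = 0`). -/
noncomputable def KL {X : Type*} [Fintype X] (r q : X → ℝ) : ℝ :=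
  ∑ x, r x * Real.log (r x / q x)

theorem hasDerivAt_shannon_add_mul {X : Type*} [Fintype X] (p d : X → ℝ)
    (h : ∀ x, p x = 0 → d x = 0) :
    HasDerivAt (fun t : ℝ => shannon (fun x => p x + t * d x))
      (-∑ x, d x * Real.log (p x) - ∑ x, d x) 0 := by
  have key : ∀ x, HasDerivAt (fun t : ℝ => (p x + t * d x) * Real.log (p x + t * d x))
      (d x * Real.log (p x) + d x) 0 := by
    intro x
    by_cases hx : p x = 0
    · simpa [hx, h x hx] using hasDerivAt_const (0 : ℝ) (0 : ℝ)
    · have hlin : HasDerivAt (fun t : ℝ => p x + t * d x) (d x) 0 := by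
        simpa using ((hasDerivAt_id (0 : ℝ)).mul_const (d x)).const_add (p x)
      have hne : p x + 0 * d x ≠ 0 := by simpa using hx
      refine (hlin.fun_mul (hlin.log hne)).congr_deriv ?_
      simp only [zero_mul, add_zero]
      field_simp
  refine (HasDerivAt.fun_sum (u := Finset.univ) fun x _ => key x).fun_neg.congr_deriv ?_
  rw [Finset.sum_add_distrib]
  ring

theorem KL_eq_neg_shannon_sub {X : Type*} [Fintype X] (r q : X → ℝ)
    (h : ∀ x, q x = 0 → r x = 0) :
    KL r q = -shannon r - ∑ x, r x * Real.log (q x) := by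
  simp only [KL, shannon, neg_neg]
  rw [← Finset.sum_sub_distrib]
  refine Finset.sum_congr rfl fun x _ => ?_
  by_cases hr : r x = 0
  · simp [hr]
  · rw [Real.log_div hr fun hq => hr (h x hq)]
    ring

theorem push_add_mul {X : Type*} [Fintype X] (P : X → X → ℝ) (p d : X → ℝ) (t : ℝ) :
    push P (fun x => p x + t * d x) = fun y => push P p y + t * push P d y := by
  funext y
  simp only [push, Finset.mul_sum, ← Finset.sum_add_distrib]
  exact Finset.sum_congr rfl fun x _ => by ring

theorem push_sub {X : Type*} [Fintype X] (P : X → X → ℝ) (r q : X → ℝ) (y : X) :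
    push P (fun x => r x - q x) y = push P r y - push P q y := by
  simp only [push, ← Finset.sum_sub_distrib, sub_mul]

theorem sum_push {X : Type*} [Fintype X] {P : X → X → ℝ} (hP : IsKernel P) (p : X → ℝ) :
    ∑ y, push P p y = ∑ x, p x := by
  simp only [push]
  rw [Finset.sum_comm]
  simp only [← Finset.mul_sum, hP.2, mul_one]

theorem push_eq_zero_of_push_eq_zero {X : Type*} [Fintype X] {P : X → X → ℝ} (hP : IsKernel P)
    {q : X → ℝ} (hq : ∀ x, 0 < q x) {y : X} (hy : push P q y = 0) (p : X → ℝ) :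
    push P p y = 0 := by
  refine Finset.sum_eq_zero fun x hx => ?_
  have hz := (Finset.sum_eq_zero_iff_of_nonneg
    fun x _ => mul_nonneg (hq x).le (hP.1 x y)).1 hy x hx
  rw [(mul_eq_zero.1 hz).resolve_left (hq x).ne', mul_zero]

theorem hasDerivAt_Wd_add_mul {X : Type*} [Fintype X] {P : X → X → ℝ} (hP : IsKernel P)
    (Q : X → ℝ) {q : X → ℝ} (hq : ∀ x, 0 < q x) {d : X → ℝ} (hd : ∑ x, d x = 0) :
    HasDerivAt (fun t : ℝ => Wd P Q (fun x => q x + t * d x))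
      (-∑ y, push P d y * Real.log (push P q y) + ∑ x, d x * Real.log (q x)
        - ∑ x, d x * Q x) 0 := by
  have hpush := hasDerivAt_shannon_add_mul (push P q) (push P d)
    fun y hy => push_eq_zero_of_push_eq_zero hP hq hy d
  have hinit := hasDerivAt_shannon_add_mul q d fun x hx => absurd hx (hq x).ne'
  have hheat : HasDerivAt (fun t : ℝ => ∑ x, (q x + t * d x) * Q x) (∑ x, d x * Q x) 0 := by
    refine HasDerivAt.fun_sum fun x _ => ?_
    simpa using (((hasDerivAt_id (0 : ℝ)).mul_const (d x)).const_add (q x)).mul_const (Q x)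
  simp only [Wd, push_add_mul]
  refine ((hpush.fun_sub hinit).fun_sub hheat).congr_deriv ?_
  rw [sum_push hP, hd]
  ring

theorem eventually_isProb_add_mul {X : Type*} [Fintype X] {q d : X → ℝ} (hq : IsProb q)
    (hqpos : ∀ x, 0 < q x) (hd : ∑ x, d x = 0) :
    ∀ᶠ t : ℝ in nhds 0, IsProb (fun x => q x + t * d x) := by
  have hpos : ∀ᶠ t : ℝ in nhds 0, ∀ x, 0 < q x + t * d x := by
    refine Filter.eventually_all.2 fun x => ?_
    have hcont : Continuous fun t : ℝ => q x + t * d x := by fun_prop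
    exact hcont.continuousAt.eventually_const_lt (by simpa using hqpos x)
  filter_upwards [hpos] with t ht
  refine ⟨fun x => (ht x).le, ?_⟩
  rw [Finset.sum_add_distrib, ← Finset.mul_sum, hq.2, hd, mul_zero, add_zero]

/-- If `q0` has full support and minimizes dissipation over all probability
distributions, then for every `r0`,
`W_d(r0) − W_d(q0) = D(r0‖q0) − D(r0P‖q0P)`. -/
theorem incorrect_prior_dissipation {X : Type*} [Fintype X] [Nonempty X]
    (P : X → X → ℝ) (Q : X → ℝ) (hP : IsKernel P)
    (q0 : X → ℝ) (hq : IsProb q0) (hqfull : ∀ x, 0 < q0 x)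
    (hmin : ∀ p : X → ℝ, IsProb p → Wd P Q q0 ≤ Wd P Q p)
    (r0 : X → ℝ) (hr : IsProb r0) :
    Wd P Q r0 - Wd P Q q0 = KL r0 q0 - KL (push P r0) (push P q0) := by
  have hd : ∑ x, (r0 x - q0 x) = 0 := by
    rw [Finset.sum_sub_distrib, hr.2, hq.2, sub_self]
  have hlocal : IsLocalMin (fun t : ℝ => Wd P Q (fun x => q0 x + t * (r0 x - q0 x))) 0 := by
    filter_upwards [eventually_isProb_add_mul hq hqfull hd] with t ht
    simpa using hmin _ ht
  have hstat := hlocal.hasDerivAt_eq_zero (hasDerivAt_Wd_add_mul hP Q hqfull hd)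
  simp only [push_sub, sub_mul, Finset.sum_sub_distrib] at hstat
  rw [KL_eq_neg_shannon_sub r0 q0 fun x hx => absurd hx (hqfull x).ne',
    KL_eq_neg_shannon_sub (push P r0) (push P q0)
      fun y hy => push_eq_zero_of_push_eq_zero hP hqfull hy r0]
  simp only [Wd]
  have hSq : shannon q0 = -∑ x, q0 x * Real.log (q0 x) := rfl
  have hSpush : shannon (push P q0) = -∑ y, push P q0 y * Real.log (push P q0 y) := rfl
  linarith
end

section
/- For all probability distributions w and w' on X and all λ ∈ [0,1], with m = λw + (1−λ)w', the convexity gap of the dissipation functional equals the drop in mutual information between the state and the mixture label under the kernel: λ W_d(w) + (1−λ) W_d(w') − W_d(m) = [ λ D(w‖m) + (1−λ) D(w'‖m) ] − [ λ D(wP‖mP) + (1−λ) D(w'P‖mP) ]. -/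
open Finset

theorem mul_log_div_of_eq_zero_imp {r a m : ℝ} (h : m = 0 → r * a = 0) :
    r * (a * Real.log (a / m)) = r * (a * Real.log a) - r * a * Real.log m := by
  by_cases hm : m = 0
  · have := h hm
    rcases mul_eq_zero.mp this with h0 | h0 <;> simp [h0]
  · by_cases ha : a = 0
    · simp [ha]
    · rw [Real.log_div ha hm]; ring

/-- The Jensen–Shannon form of the mutual information between state and mixture label. -/
theorem mix_KL_eq_shannon_gap {X : Type*} [Fintype X] {u v : X → ℝ}
    (hu : ∀ x, 0 ≤ u x) (hv : ∀ x, 0 ≤ v x) {l : ℝ} (hl0 : 0 ≤ l) (hl1 : l ≤ 1) :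
    l * KL u (fun x => l * u x + (1 - l) * v x)
        + (1 - l) * KL v (fun x => l * u x + (1 - l) * v x)
      = shannon (fun x => l * u x + (1 - l) * v x) - l * shannon u - (1 - l) * shannon v := by
  simp only [KL, shannon, mul_sum, ← sum_neg_distrib, ← sum_sub_distrib,
    ← sum_add_distrib]
  refine sum_congr rfl fun x _ => ?_
  have h1 : 0 ≤ l * u x := mul_nonneg hl0 (hu x)
  have h2 : 0 ≤ (1 - l) * v x := mul_nonneg (sub_nonneg.mpr hl1) (hv x)
  rw [mul_log_div_of_eq_zero_imp fun h => by linarith, mul_log_div_of_eq_zero_imp fun h => by linarith]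
  ring

theorem push_mix {X : Type*} [Fintype X] (P : X → X → ℝ) (u v : X → ℝ) (l : ℝ) :
    push P (fun x => l * u x + (1 - l) * v x)
      = fun x => l * push P u x + (1 - l) * push P v x := by
  funext y
  simp only [push, mul_sum, ← sum_add_distrib]
  exact sum_congr rfl fun x _ => by ring

/-- The convexity gap of the dissipation functional equals the drop in
mutual information between state and mixture label under the kernel. -/
theorem dissipation_convexity_gap {X : Type*} [Fintype X] [Nonempty X]
    (P : X → X → ℝ) (Q : X → ℝ) (hP : IsKernel P)
    (w w' : X → ℝ) (hw : IsProb w) (hw' : IsProb w')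
    (l : ℝ) (hl0 : 0 ≤ l) (hl1 : l ≤ 1) :
    l * Wd P Q w + (1 - l) * Wd P Q w'
        - Wd P Q (fun x => l * w x + (1 - l) * w' x)
      = (l * KL w (fun x => l * w x + (1 - l) * w' x)
            + (1 - l) * KL w' (fun x => l * w x + (1 - l) * w' x))
        - (l * KL (push P w) (push P (fun x => l * w x + (1 - l) * w' x))
            + (1 - l) * KL (push P w') (push P (fun x => l * w x + (1 - l) * w' x))) := by
  have hpush : ∀ p : X → ℝ, IsProb p → ∀ x, 0 ≤ push P p x := fun p hp x =>
    sum_nonneg fun y _ => mul_nonneg (hp.1 y) (hP.1 y x)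
  have hQ : ∑ x, (l * w x + (1 - l) * w' x) * Q x
      = l * ∑ x, w x * Q x + (1 - l) * ∑ x, w' x * Q x := by
    simp only [mul_sum, ← sum_add_distrib]
    exact sum_congr rfl fun x _ => by ring
  rw [mix_KL_eq_shannon_gap hw.1 hw'.1 hl0 hl1, push_mix,
    mix_KL_eq_shannon_gap (hpush w hw) (hpush w' hw') hl0 hl1]
  simp only [Wd, push_mix, hQ]
  ring
end

section
/- Suppose the kernel P is strictly positive, i.e., P(x1|x0) > 0 for all x0, x1. Then every probability distribution q0 that minimizes the dissipation functional W_d over all probability distributions on X has full support: q0(x) > 0 for all x. -/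
open Finset

/-- The mixture `(1 - t) q + t δ_a`. -/
noncomputable def mixDirac {X : Type*} (q : X → ℝ) (a : X) (t : ℝ) : X → ℝ :=
  open Classical in fun x => (1 - t) * q x + if x = a then t else 0

theorem sum_mixDirac_mul {X : Type*} [Fintype X] (q f : X → ℝ) (a : X) (t : ℝ) :
    ∑ x, mixDirac q a t x * f x = (1 - t) * ∑ x, q x * f x + t * f a := by
  classical
  simp only [mixDirac, add_mul, ite_mul, zero_mul, sum_add_distrib, mul_assoc, ← mul_sum,
    sum_ite_eq', mem_univ, if_true]

theorem isProb_mixDirac {X : Type*} [Fintype X] {q : X → ℝ} (hq : IsProb q) (a : X) {t : ℝ}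
    (ht0 : 0 ≤ t) (ht1 : t ≤ 1) : IsProb (mixDirac q a t) := by
  refine ⟨fun x => ?_, ?_⟩
  · have := mul_nonneg (sub_nonneg.2 ht1) (hq.1 x)
    unfold mixDirac
    split_ifs <;> linarith
  · simpa [hq.2] using sum_mixDirac_mul q (fun _ => 1) a t

theorem push_mixDirac {X : Type*} [Fintype X] (P : X → X → ℝ) (q : X → ℝ) (a : X) (t : ℝ)
    (y : X) : push P (mixDirac q a t) y = push P q y + t * (P a y - push P q y) := by
  rw [push, sum_mixDirac_mul q (fun x => P x y), push]
  ring

/-- Mixing in a point mass outside the support splits the entropy additively. -/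
theorem shannon_mixDirac {X : Type*} [Fintype X] {q : X → ℝ} (hq : IsProb q) {a : X}
    (ha : q a = 0) {t : ℝ} (ht1 : t < 1) :
    shannon (mixDirac q a t) =
      (1 - t) * shannon q - (1 - t) * Real.log (1 - t) - t * Real.log t := by
  classical
  have key : ∀ x, mixDirac q a t x * Real.log (mixDirac q a t x) =
      (1 - t) * (q x * Real.log (q x)) + q x * ((1 - t) * Real.log (1 - t)) +
        if x = a then t * Real.log t else 0 := by
    intro x
    by_cases hx : x = a
    · subst hx
      simp [mixDirac, ha]
    · by_cases h0 : q x = 0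
      · simp [mixDirac, hx, h0]
      · simp only [mixDirac, hx, if_false, add_zero]
        rw [Real.log_mul (sub_pos.2 ht1).ne' h0]
        ring
  simp only [shannon, key, sum_add_distrib, ← mul_sum, ← sum_mul, hq.2, sum_ite_eq', mem_univ,
    if_true]
  ring

/-- The graph of `x ↦ -x log x` lies below its tangent at `r`. -/
theorem neg_mul_log_le_tangent {r m : ℝ} (hr : 0 < r) (hm : 0 < m) :
    -(m * Real.log m) ≤ -(r * Real.log r) - (Real.log r + 1) * (m - r) := by
  have h := mul_le_mul_of_nonneg_left (Real.log_le_sub_one_of_pos (div_pos hr hm)) hm.le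
  rw [Real.log_div hr.ne' hm.ne', mul_sub, mul_sub, mul_div_cancel₀ _ hm.ne'] at h
  linarith

theorem shannon_le_tangent {X : Type*} [Fintype X] {r m : X → ℝ} (hr : ∀ x, 0 < r x)
    (hm : ∀ x, 0 < m x) :
    shannon m ≤ shannon r - ∑ x, (Real.log (r x) + 1) * (m x - r x) := by
  simp only [shannon, ← sum_neg_distrib, ← sum_sub_distrib]
  exact sum_le_sum fun x _ => neg_mul_log_le_tangent (hr x) (hm x)

theorem push_pos {X : Type*} [Fintype X] {P : X → X → ℝ} (hP : ∀ x0 x1, 0 < P x0 x1)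
    {p : X → ℝ} (hp : IsProb p) (y : X) : 0 < push P p y := by
  have hne : ∑ x, p x ≠ 0 := by simp [hp.2]
  obtain ⟨x, -, hx⟩ := exists_ne_zero_of_sum_ne_zero hne
  exact sum_pos' (fun z _ => mul_nonneg (hp.1 z) (hP z y).le)
    ⟨x, mem_univ x, mul_pos ((hp.1 x).lt_of_ne' hx) (hP x y)⟩

/-- If the kernel is strictly positive, then every minimizer of the
dissipation functional over probability distributions has full support. -/
theorem prior_full_support_of_positive_kernel {X : Type*} [Fintype X] [Nonempty X]
    (P : X → X → ℝ) (Q : X → ℝ) (hP : IsKernel P)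
    (hPpos : ∀ x0 x1, 0 < P x0 x1)
    (q0 : X → ℝ) (hq : IsProb q0)
    (hmin : ∀ p : X → ℝ, IsProb p → Wd P Q q0 ≤ Wd P Q p) :
    ∀ x, 0 < q0 x := by
  intro a
  by_contra hneg
  have ha : q0 a = 0 := le_antisymm (not_lt.1 hneg) (hq.1 a)
  set C : ℝ := -∑ y, (Real.log (push P q0 y) + 1) * (P a y - push P q0 y) + shannon q0
    + ∑ x, q0 x * Q x - Q a with hC
  set t : ℝ := Real.exp (-|C| - 1) with ht
  have ht0 : 0 < t := Real.exp_pos _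
  have ht1 : t < 1 := Real.exp_lt_one_iff.2 (by linarith [abs_nonneg C])
  have hlog : Real.log t = -|C| - 1 := Real.log_exp _
  have hp := isProb_mixDirac hq a ht0.le ht1.le
  have hW := hmin _ hp
  have hS := shannon_le_tangent (push_pos hPpos hq) (push_pos hPpos hp)
  have hsum : ∑ y, (Real.log (push P q0 y) + 1) * (push P (mixDirac q0 a t) y - push P q0 y) =
      t * ∑ y, (Real.log (push P q0 y) + 1) * (P a y - push P q0 y) := by
    rw [mul_sum]
    refine sum_congr rfl fun y _ => ?_
    rw [push_mixDirac]
    ring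
  rw [hsum] at hS
  have hmix : (1 - t) * Real.log (1 - t) ≤ 0 :=
    Real.mul_log_nonpos (by linarith) (by linarith)
  simp only [Wd, shannon_mixDirac hq ha ht1, sum_mixDirac_mul] at hW
  have hgap : 0 ≤ t * (C + Real.log t) := by
    rw [hC]
    linarith
  have hlt : t * (C + Real.log t) < 0 :=
    mul_neg_of_pos_of_neg ht0 (by linarith [le_abs_self C])
  linarith
end

section
/- Suppose q0 is a probability distribution on X with full support that minimizes the dissipation functional W_d over all probability distributions on X. Then there exists a probability distribution r0 on X with W_d(r0) − W_d(q0) > 0 if and only if P is not an invertible (permutation) map, i.e., there is no bijection σ : X → X such that P(x1|x0) = 1 when x1 = σ(x0) and P(x1|x0) = 0 otherwise. -/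
open Finset

lemma isProb_single {X : Type*} [Fintype X] [DecidableEq X] (x : X) :
    IsProb (Pi.single x (1 : ℝ)) := by
  refine ⟨fun y => ?_, by simp⟩
  by_cases h : y = x
  · subst h; simp
  · simp [h]

lemma push_single {X : Type*} [Fintype X] [DecidableEq X] (P : X → X → ℝ) (x : X) :
    push P (Pi.single x (1 : ℝ)) = P x := by
  funext y
  simp [push, Pi.single_apply]

lemma shannon_single {X : Type*} [Fintype X] [DecidableEq X] (x : X) :
    shannon (Pi.single x (1 : ℝ)) = 0 := by
  simp [shannon, Pi.single_apply]

lemma Wd_single {X : Type*} [Fintype X] [DecidableEq X] (P : X → X → ℝ) (Q : X → ℝ) (x : X) :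
    Wd P Q (Pi.single x (1 : ℝ)) = shannon (P x) - Q x := by
  simp [Wd, push_single, shannon_single, Pi.single_apply]

/-- A permutation kernel preserves Shannon entropy. -/
lemma shannon_push_perm {X : Type*} [Fintype X] [DecidableEq X] {P : X → X → ℝ}
    (σ : Equiv.Perm X) (hσ : ∀ x0 x1, P x0 x1 = if x1 = σ x0 then 1 else 0) (p : X → ℝ) :
    shannon (push P p) = shannon p := by
  have h : ∀ x, push P p (σ x) = p x := fun x => by
    simp [push, hσ, σ.injective.eq_iff]
  unfold shannon
  rw [← Equiv.sum_comp σ]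
  simp [h]

/-- A linear functional maximized over the simplex at an interior point is constant. -/
lemma eq_sum_of_forall_le {X : Type*} [Fintype X] {q Q : X → ℝ}
    (hq : IsProb q) (hfull : ∀ x, 0 < q x) (h : ∀ x, Q x ≤ ∑ y, q y * Q y) (x : X) :
    Q x = ∑ y, q y * Q y := by
  set m := ∑ y, q y * Q y with hm
  have h0 : ∑ y, q y * (m - Q y) = 0 := by
    simp only [mul_sub, sum_sub_distrib, ← sum_mul, hq.2, ← hm]
    ring
  have h1 := (sum_eq_zero_iff_of_nonneg
    (fun y _ => mul_nonneg (hfull y).le (sub_nonneg.2 (h y)))).1 h0 x (mem_univ x)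
  rcases mul_eq_zero.1 h1 with h2 | h2
  · exact absurd h2 (hfull x).ne'
  · linarith

/-- If the conditional entropy of the input given the output vanishes, each output is reached
from at most one input. -/
lemma eq_zero_of_condEntropy_eq_zero {X : Type*} [Fintype X] [DecidableEq X] {P : X → X → ℝ}
    (hP : IsKernel P) {q : X → ℝ} (hfull : ∀ x, 0 < q x)
    (h : ∑ x, ∑ y, q x * P x y *
      (Real.log (push P q y) - Real.log (q x) - Real.log (P x y)) = 0)
    {x x' y : X} (hxy : 0 < P x y) (hne : x' ≠ x) : P x' y = 0 := by
  have hterm : ∀ a b, 0 ≤ q a * P a b := fun a b => mul_nonneg (hfull a).le (hP.1 a b)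
  have hle : ∀ a b, q a * P a b ≤ push P q b := fun a b =>
    single_le_sum (f := fun a => q a * P a b) (fun c _ => hterm c b) (mem_univ a)
  have hnn : ∀ a b, 0 ≤ q a * P a b *
      (Real.log (push P q b) - Real.log (q a) - Real.log (P a b)) := by
    intro a b
    rcases (hP.1 a b).eq_or_lt with h0 | h0
    · simp [← h0]
    · refine mul_nonneg (hterm a b) ?_
      have h1 := Real.log_le_log (mul_pos (hfull a) h0) (hle a b)
      rw [Real.log_mul (hfull a).ne' h0.ne'] at h1
      linarith
  have h1 := (sum_eq_zero_iff_of_nonneg fun a _ => sum_nonneg fun b _ => hnn a b).1 h x (mem_univ x)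
  have h2 := (sum_eq_zero_iff_of_nonneg fun b _ => hnn x b).1 h1 y (mem_univ y)
  have hpos := mul_pos (hfull x) hxy
  have h3 := (mul_eq_zero.1 h2).resolve_left hpos.ne'
  have h4 : push P q y = q x * P x y := by
    refine Real.log_injOn_pos (Set.mem_Ioi.2 (hpos.trans_le (hle x y))) (Set.mem_Ioi.2 hpos) ?_
    rw [Real.log_mul (hfull x).ne' hxy.ne']
    linarith
  have h5 : ∑ a ∈ univ.erase x, q a * P a y = 0 := by
    have := add_sum_erase univ (fun a => q a * P a y) (mem_univ x)
    simp only [push] at h4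
    linarith
  have h6 := (sum_eq_zero_iff_of_nonneg fun a _ => hterm a y).1 h5 x'
    (mem_erase.2 ⟨hne, mem_univ x'⟩)
  exact (mul_eq_zero.1 h6).resolve_left (hfull x').ne'

/-- A stochastic kernel whose rows have disjoint supports is a permutation. -/
lemma exists_perm_of_disjoint_rows {X : Type*} [Fintype X] [DecidableEq X] {P : X → X → ℝ}
    (hP : IsKernel P) (h : ∀ x x' y, 0 < P x y → x' ≠ x → P x' y = 0) :
    ∃ σ : Equiv.Perm X, ∀ x0 x1, P x0 x1 = if x1 = σ x0 then 1 else 0 := by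
  have hex : ∀ x, ∃ y, 0 < P x y := fun x => by
    by_contra! hcon
    have := sum_nonpos fun y (_ : y ∈ univ) => hcon y
    linarith [hP.2 x]
  choose f hf using hex
  have hinj : Function.Injective f := fun a b hab => by
    by_contra hne
    have h1 := h a b (f a) (hf a) (Ne.symm hne)
    rw [hab] at h1
    exact (hf b).ne' h1
  have hsurj := Finite.injective_iff_surjective.1 hinj
  have hoff : ∀ x y, y ≠ f x → P x y = 0 := fun x y hne => by
    obtain ⟨z, rfl⟩ := hsurj y
    exact h z x (f z) (hf z) fun hxz => hne (by rw [hxz])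
  refine ⟨Equiv.ofBijective f ⟨hinj, hsurj⟩, fun x y => ?_⟩
  change P x y = if y = f x then 1 else 0
  split_ifs with hy
  · subst hy
    rw [← hP.2 x, sum_eq_single (f x) (fun b _ hb => hoff x b hb) (by simp)]
  · exact hoff x y hy

/-- When every point mass has the same dissipation as `q`, the conditional entropy of the input
given the output vanishes at `q`. -/
lemma condEntropy_eq_zero {X : Type*} [Fintype X] {P : X → X → ℝ} {Q q : X → ℝ}
    (hP : IsKernel P) (hq : IsProb q) (h : ∀ x, shannon (P x) - Q x = Wd P Q q) :
    ∑ x, ∑ y, q x * P x y *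
      (Real.log (push P q y) - Real.log (q x) - Real.log (P x y)) = 0 := by
  have hQ : ∑ x, q x * Q x = ∑ x, q x * shannon (P x) - Wd P Q q := by
    have hx : ∀ x, q x * Q x = q x * shannon (P x) - q x * Wd P Q q := fun x => by
      rw [← h x]; ring
    simp only [hx, sum_sub_distrib, ← sum_mul, hq.2, one_mul]
  have h1 : ∑ x, ∑ y, q x * P x y * Real.log (push P q y) = -shannon (push P q) := by
    rw [sum_comm, shannon, neg_neg]
    simp only [← sum_mul]
    rfl
  have h2 : ∑ x, ∑ y, q x * P x y * Real.log (q x) = -shannon q := by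
    simp only [← sum_mul, ← mul_sum, hP.2, mul_one, shannon, neg_neg]
  have h3 : ∑ x, ∑ y, q x * P x y * Real.log (P x y) = -∑ x, q x * shannon (P x) := by
    simp only [shannon, mul_neg, sum_neg_distrib, neg_neg, mul_sum, mul_assoc]
  have h4 : Wd P Q q = shannon (push P q) - shannon q - ∑ x, q x * Q x := rfl
  simp only [mul_sub, sum_sub_distrib, h1, h2, h3]
  linarith

/-- For a full-support minimizer `q0`, there exists an initial distribution
with strictly positive incorrect prior dissipation iff `P` is not a permutation kernel. -/
theorem positive_dissipation_iff_not_permutation {X : Type*} [Fintype X] [Nonempty X] [DecidableEq X]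
    (P : X → X → ℝ) (Q : X → ℝ) (hP : IsKernel P)
    (q0 : X → ℝ) (hq : IsProb q0) (hqfull : ∀ x, 0 < q0 x)
    (hmin : ∀ p : X → ℝ, IsProb p → Wd P Q q0 ≤ Wd P Q p) :
    (∃ r0 : X → ℝ, IsProb r0 ∧ 0 < Wd P Q r0 - Wd P Q q0) ↔
      ¬ ∃ σ : Equiv.Perm X, ∀ x0 x1, P x0 x1 = if x1 = σ x0 then 1 else 0 := by
  constructor
  · rintro ⟨r0, hr, hpos⟩ ⟨σ, hσ⟩
    have hW : ∀ p, Wd P Q p = -∑ x, p x * Q x := fun p => by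
      simp [Wd, shannon_push_perm σ hσ]
    have hQ := eq_sum_of_forall_le (Q := Q) hq hqfull fun x => by
      have := hmin _ (isProb_single x)
      rw [hW, hW] at this
      simpa [Pi.single_apply] using this
    have hsum : ∑ x, r0 x * Q x = ∑ x, q0 x * Q x := by
      rw [sum_congr rfl fun x _ => congrArg (r0 x * ·) (hQ x), ← sum_mul, hr.2, one_mul]
    rw [hW, hW, hsum, sub_self] at hpos
    exact lt_irrefl _ hpos
  · contrapose!
    intro hle
    refine exists_perm_of_disjoint_rows hP fun x x' y hxy hne =>
      eq_zero_of_condEntropy_eq_zero hP hqfull (condEntropy_eq_zero (Q := Q) hP hq fun z => ?_)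
        hxy hne
    have hz := isProb_single z
    rw [← Wd_single]
    exact le_antisymm (sub_nonpos.1 (hle _ hz)) (hmin _ hz)
end

section
/- Suppose the kernel is input-independent, i.e., there is a probability distribution μ on X with P(x1|x0) = μ(x1) for all x0, x1, and suppose q0 is a probability distribution with full support that minimizes the dissipation functional W_d over all probability distributions on X. Then for every probability distribution r0, W_d(r0) − W_d(q0) = D(r0‖q0); consequently W_d(r0) = W_d(q0) if and only if r0 = q0, so the minimizer q0 is unique. -/
open Finset

open InformationTheory in
theorem KL_eq_sum_mul_klFun {X : Type*} [Fintype X] {r q : X → ℝ} (hr : IsProb r)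
    (hq : IsProb q) (hpos : ∀ x, 0 < q x) : KL r q = ∑ x, q x * klFun (r x / q x) := by
  have key : ∀ x, q x * klFun (r x / q x) = r x * Real.log (r x / q x) + (q x - r x) := by
    intro x
    have := (hpos x).ne'
    rw [klFun]
    field_simp
    ring
  simp_rw [key, sum_add_distrib, sum_sub_distrib, hr.2, hq.2, KL, sub_self, add_zero]

/-- Gibbs' inequality with its equality case. -/
theorem KL_nonpos_iff {X : Type*} [Fintype X] {r q : X → ℝ} (hr : IsProb r)
    (hq : IsProb q) (hpos : ∀ x, 0 < q x) : KL r q ≤ 0 ↔ r = q := by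
  have hratio : ∀ x, 0 ≤ r x / q x := fun x => div_nonneg (hr.1 x) (hq.1 x)
  have hterm : ∀ x ∈ univ, 0 ≤ q x * InformationTheory.klFun (r x / q x) := fun x _ =>
    mul_nonneg (hq.1 x) (InformationTheory.klFun_nonneg (hratio x))
  rw [KL_eq_sum_mul_klFun hr hq hpos, (sum_nonneg hterm).ge_iff_eq', sum_eq_zero_iff_of_nonneg hterm,
    funext_iff]
  refine forall_congr' fun x => ?_
  simp [InformationTheory.klFun_eq_zero_iff (hratio x), (hpos x).ne',
    div_eq_one_iff_eq (hpos x).ne']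

theorem KL_self {X : Type*} [Fintype X] {q : X → ℝ} (hpos : ∀ x, 0 < q x) : KL q q = 0 := by
  simp [KL, div_self (hpos _).ne']

/-- The Gibbs distribution proportional to `exp Q`. -/
noncomputable def gibbs {X : Type*} [Fintype X] (Q : X → ℝ) : X → ℝ :=
  fun x => Real.exp (Q x) / ∑ y, Real.exp (Q y)

theorem sum_exp_pos {X : Type*} [Fintype X] [Nonempty X] (Q : X → ℝ) :
    0 < ∑ y, Real.exp (Q y) :=
  sum_pos (fun y _ => Real.exp_pos (Q y)) univ_nonempty

theorem gibbs_pos {X : Type*} [Fintype X] [Nonempty X] (Q : X → ℝ) (x : X) : 0 < gibbs Q x :=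
  div_pos (Real.exp_pos _) (sum_exp_pos Q)

theorem isProb_gibbs {X : Type*} [Fintype X] [Nonempty X] (Q : X → ℝ) : IsProb (gibbs Q) := by
  refine ⟨fun x => (gibbs_pos Q x).le, ?_⟩
  simp only [gibbs]
  rw [← sum_div, div_self (sum_exp_pos Q).ne']

theorem push_eq_of_input_independent {X : Type*} [Fintype X] {P : X → X → ℝ} {μ p : X → ℝ}
    (hPμ : ∀ x0 x1, P x0 x1 = μ x1) (hp : IsProb p) : push P p = μ := by
  funext x
  simp only [push, hPμ]
  rw [← sum_mul, hp.2, one_mul]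

theorem KL_gibbs {X : Type*} [Fintype X] [Nonempty X] (Q : X → ℝ) {p : X → ℝ} (hp : IsProb p) :
    KL p (gibbs Q) = -shannon p - ∑ x, p x * Q x + Real.log (∑ y, Real.exp (Q y)) := by
  have key : ∀ x, p x * Real.log (p x / gibbs Q x) =
      p x * Real.log (p x) - p x * Q x + p x * Real.log (∑ y, Real.exp (Q y)) := by
    intro x
    rcases eq_or_ne (p x) 0 with h | h
    · simp [h]
    · rw [Real.log_div h (gibbs_pos Q x).ne', gibbs,
        Real.log_div (Real.exp_pos _).ne' (sum_exp_pos Q).ne', Real.log_exp]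
      ring
  simp_rw [KL, key, sum_add_distrib, sum_sub_distrib]
  rw [← sum_mul, hp.2, one_mul, shannon, neg_neg]

/-- For an input-independent kernel the dissipation is, up to a constant, the divergence from
the Gibbs distribution. -/
theorem Wd_eq_KL_gibbs {X : Type*} [Fintype X] [Nonempty X] {P : X → X → ℝ} {μ : X → ℝ}
    (Q : X → ℝ) (hPμ : ∀ x0 x1, P x0 x1 = μ x1) {p : X → ℝ} (hp : IsProb p) :
    Wd P Q p = KL p (gibbs Q) + (shannon μ - Real.log (∑ y, Real.exp (Q y))) := by
  rw [Wd, push_eq_of_input_independent hPμ hp, KL_gibbs Q hp]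
  ring

/-- For an input-independent kernel (`P(x1|x0) = μ(x1)`), incorrect prior
dissipation equals `D(r0‖q0)`, and the full-support minimizer is unique. -/
theorem input_independent_kernel_dissipation {X : Type*} [Fintype X] [Nonempty X]
    (P : X → X → ℝ) (Q : X → ℝ) (hP : IsKernel P)
    (μ : X → ℝ) (hμ : IsProb μ) (hPμ : ∀ x0 x1, P x0 x1 = μ x1)
    (q0 : X → ℝ) (hq : IsProb q0) (hqfull : ∀ x, 0 < q0 x)
    (hmin : ∀ p : X → ℝ, IsProb p → Wd P Q q0 ≤ Wd P Q p) :
    ∀ r0 : X → ℝ, IsProb r0 →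
      (Wd P Q r0 - Wd P Q q0 = KL r0 q0 ∧ (Wd P Q r0 = Wd P Q q0 ↔ r0 = q0)) := by
  have hg := isProb_gibbs Q
  have hgpos := gibbs_pos Q
  have hqg : q0 = gibbs Q := by
    rw [← KL_nonpos_iff hq hg hgpos]
    have := hmin _ hg
    rw [Wd_eq_KL_gibbs Q hPμ hq, Wd_eq_KL_gibbs Q hPμ hg, KL_self hgpos] at this
    linarith
  intro r0 hr
  have hW : Wd P Q r0 - Wd P Q q0 = KL r0 q0 := by
    rw [Wd_eq_KL_gibbs Q hPμ hr, Wd_eq_KL_gibbs Q hPμ hq, hqg, KL_self hgpos]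
    ring
  refine ⟨hW, fun h => ?_, fun h => by rw [h]⟩
  rw [← KL_nonpos_iff hr hq hqfull, ← hW, h, sub_self]
end

section
/- Let M be a row-stochastic matrix indexed by the finite set X, let q be a probability distribution on X with full support, and let r be any probability distribution on X. Suppose the Bayesian posteriors of r and q under M coincide: for every x0 ∈ X and every x1 with (rM)(x1) > 0, r(x0) M(x0, x1) / (rM)(x1) = q(x0) M(x0, x1) / (qM)(x1). Then the ℓ1 norm of s = r − q is preserved by M: Σ_{x1} | Σ_{x0} s(x0) M(x0, x1) | = Σ_{x0} |s(x0)|. -/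
open Finset

/-- If the posteriors of `r` and `q` given the output `x1` coincide, the joint weights
`r x0 * M x0 x1` are proportional to `q x0 * M x0 x1`. -/
theorem exists_ratio_of_equal_posteriors {X : Type*} [Fintype X]
    (M : X → X → ℝ) (hM : IsKernel M) (r : X → ℝ) (hr : ∀ x, 0 ≤ r x) (q : X → ℝ) (x1 : X)
    (hpost : ∀ x0, 0 < push M r x1 →
      r x0 * M x0 x1 / push M r x1 = q x0 * M x0 x1 / push M q x1) :
    ∃ c : ℝ, ∀ x0, r x0 * M x0 x1 = c * (q x0 * M x0 x1) := by
  have hrM : ∀ x0 ∈ Finset.univ, 0 ≤ r x0 * M x0 x1 :=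
    fun x0 _ => mul_nonneg (hr x0) (hM.1 x0 x1)
  have hpush : 0 ≤ push M r x1 := Finset.sum_nonneg hrM
  rcases hpush.eq_or_lt with h | h
  · refine ⟨0, fun x0 => ?_⟩
    rw [zero_mul]
    exact (Finset.sum_eq_zero_iff_of_nonneg hrM).1 h.symm x0 (Finset.mem_univ x0)
  · refine ⟨push M r x1 / push M q x1, fun x0 => ?_⟩
    rw [(div_eq_iff h.ne').1 (hpost x0 h)]
    ring

/-- If the Bayesian posteriors of `r` and `q` under the row-stochastic
matrix `M` coincide (for outputs of positive probability under `r`), then the ℓ1 norm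
of `s = r − q` is preserved by `M`. -/
theorem l1_norm_preserved_of_equal_posteriors {X : Type*} [Fintype X] [Nonempty X]
    (M : X → X → ℝ) (hM : IsKernel M)
    (q : X → ℝ) (hq : IsProb q) (hqfull : ∀ x, 0 < q x)
    (r : X → ℝ) (hr : IsProb r)
    (hpost : ∀ x0 x1, 0 < push M r x1 →
      r x0 * M x0 x1 / push M r x1 = q x0 * M x0 x1 / push M q x1) :
    ∑ x1, |∑ x0, (r x0 - q x0) * M x0 x1| = ∑ x0, |r x0 - q x0| := by
  have hcol : ∀ x1, |∑ x0, (r x0 - q x0) * M x0 x1| = ∑ x0, |r x0 - q x0| * M x0 x1 := by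
    intro x1
    obtain ⟨c, hc⟩ := exists_ratio_of_equal_posteriors M hM r hr.1 q x1 (hpost · x1)
    have hs : ∀ x0, (r x0 - q x0) * M x0 x1 = (c - 1) * (q x0 * M x0 x1) := fun x0 => by
      rw [sub_mul, hc]; ring
    have hqM : ∀ x0, 0 ≤ q x0 * M x0 x1 := fun x0 => mul_nonneg (hqfull x0).le (hM.1 x0 x1)
    calc |∑ x0, (r x0 - q x0) * M x0 x1|
        = |c - 1| * ∑ x0, q x0 * M x0 x1 := by
          rw [Finset.sum_congr rfl fun x0 _ => hs x0, ← Finset.mul_sum, abs_mul,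
            abs_of_nonneg (Finset.sum_nonneg fun x0 _ => hqM x0)]
      _ = ∑ x0, |r x0 - q x0| * M x0 x1 := by
          rw [Finset.mul_sum]
          refine Finset.sum_congr rfl fun x0 _ => ?_
          rw [← abs_of_nonneg (hqM x0), ← abs_mul, ← hs, abs_mul, abs_of_nonneg (hM.1 x0 x1)]
  rw [Finset.sum_congr rfl fun x1 _ => hcol x1, Finset.sum_comm]
  refine Finset.sum_congr rfl fun x0 _ => ?_
  rw [← Finset.mul_sum, hM.2, mul_one]
end
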